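/- Let P = σ̄∖L be a relative n-simplex, where σ̄ is the complex of all subsets of an (n+1)-element set σ and L is the subcomplex generated by finitely many proper faces of σ. Then there exists a finite sequence of stellar subdivisions, each performed at a facet of the current relative simplicial complex, starting from P, after which the resulting relative simplicial complex carries a shellable Morse tiling. Moreover, this tiling uses a Morse tile of order 0 if and only if no ridge of σ (face of cardinality n) belongs to L, it uses an open simplex if and only if every ridge of σ belongs to L, and in each case such a tile is unique. -/

import Mathlib

open Finset

variable {V : Type*} [DecidableEq V]

/-- A finite simplicial complex: a finite collection of finite sets of vertices
closed under taking subsets. -/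
def IsComplex (K : Finset (Finset V)) : Prop :=
  ∀ σ ∈ K, ∀ τ ⊆ σ, τ ∈ K

/-- The set of nonempty faces of the relative simplicial complex `K ∖ L`. -/
def relFaces (K L : Finset (Finset V)) : Finset (Finset V) :=
  (K \ L).filter (fun τ => τ ≠ ∅)

/-- A set `A` of faces is closed in `S`: every nonempty face of `S` contained in a
member of `A` belongs to `A`. -/
def closedIn (S A : Finset (Finset V)) : Prop :=
  ∀ τ ∈ S, τ ≠ ∅ → ∀ α ∈ A, τ ⊆ α → τ ∈ A

/-- A facet: a maximal face. -/
def IsFacetOf (K : Finset (Finset V)) (θ : Finset V) : Prop :=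
  θ ∈ K ∧ ∀ σ ∈ K, θ ⊆ σ → σ = θ

instance (K : Finset (Finset V)) (θ : Finset V) : Decidable (IsFacetOf K θ) :=
  inferInstanceAs (Decidable (θ ∈ K ∧ ∀ σ ∈ K, θ ⊆ σ → σ = θ))

/-- A ridge: a face of codimension one in every facet containing it. -/
def IsRidgeOf (K : Finset (Finset V)) (θ : Finset V) : Prop :=
  θ ∈ K ∧ ∀ σ, IsFacetOf K σ → θ ⊆ σ → σ.card = θ.card + 1

/-- Stellar subdivision of `K` at the face `θ`, using the new vertex `v`. -/
def stellar (K : Finset (Finset V)) (θ : Finset V) (v : V) : Finset (Finset V) :=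
  K.filter (fun σ => ¬ θ ⊆ σ) ∪
    (K.filter (fun ρ => ¬ θ ⊆ ρ ∧ ρ ∪ θ ∈ K)).image (fun ρ => insert v ρ)

/-- Barycentric subdivision: faces are the chains of nonempty faces of `K`. -/
def barySd (K : Finset (Finset V)) : Finset (Finset (Finset V)) :=
  K.powerset.filter (fun c => ∅ ∉ c ∧ ∀ τ ∈ c, ∀ τ' ∈ c, τ ⊆ τ' ∨ τ' ⊆ τ)

/-- A Morse tile: a simplex `simplex` deprived of the ridges not containing `res`,
together possibly with a Morse face `morse` of higher codimension. -/
structure MorseTile (V : Type*) where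
  simplex : Finset V
  res : Finset V
  morse : Option (Finset V)
  simplex_nonempty : simplex.Nonempty
  res_sub : res ⊆ simplex
  morse_res : ∀ μ ∈ morse, res ⊆ μ
  morse_ssub : ∀ μ ∈ morse, μ ⊂ simplex
  morse_card : ∀ μ ∈ morse, μ.card + 2 ≤ simplex.card

namespace MorseTile

/-- The face set of a Morse tile. -/
def faceSet (T : MorseTile V) : Finset (Finset V) :=
  match T.morse with
  | none => T.simplex.powerset.filter (fun τ => T.res ⊆ τ ∧ τ ≠ ∅)
  | some μ => T.simplex.powerset.filter (fun τ => T.res ⊆ τ ∧ ¬ τ ⊆ μ)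

/-- The dimension of a Morse tile. -/
def dim (T : MorseTile V) : ℕ := T.simplex.card - 1

/-- The order of a Morse tile. -/
def order (T : MorseTile V) : ℕ := T.res.card

/-- The index of a (critical) Morse tile. -/
def index (T : MorseTile V) : ℕ :=
  if T.res = T.simplex then T.simplex.card - 1 else T.res.card

/-- Basic tiles: no Morse face. -/
def IsBasic (T : MorseTile V) : Prop := T.morse = none

/-- Critical tiles: the Morse face equals the restriction set, or the open simplex. -/
def IsCritical (T : MorseTile V) : Prop := T.morse = some T.res ∨ T.res = T.simplex

/-- Tiles allowed in an h-tiling: basic or critical tiles. -/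
def IsHTile (T : MorseTile V) : Prop := T.morse = none ∨ T.morse = some T.res

/-- The closed simplex. -/
def IsClosedSimplex (T : MorseTile V) : Prop := T.morse = none ∧ T.res = ∅

/-- The open simplex. -/
def IsOpenSimplex (T : MorseTile V) : Prop := T.morse = none ∧ T.res = T.simplex

instance (T : MorseTile V) : Decidable T.IsCritical :=
  inferInstanceAs (Decidable (T.morse = some T.res ∨ T.res = T.simplex))

/-- Isomorphism of Morse tiles: a bijection between the underlying simplices mapping
the face set of one onto the face set of the other. -/
def Isom (T T' : MorseTile V) : Prop :=
  ∃ e : V → V, Set.InjOn e (T.simplex : Set V) ∧ T.simplex.image e = T'.simplex ∧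
    T.faceSet.image (fun τ => τ.image e) = T'.faceSet

/-- The subcomplex `L_T` of removed faces of a Morse tile. -/
def removed (T : MorseTile V) : Finset (Finset V) :=
  T.simplex.powerset.filter (fun τ => τ ∉ T.faceSet)

/-- The stellar subdivision of a Morse tile at a face `θ` of its underlying simplex,
as a relative simplicial complex. -/
def stellarSub (T : MorseTile V) (θ : Finset V) (v : V) : Finset (Finset V) :=
  relFaces (stellar T.simplex.powerset θ v) (stellar T.removed θ v)

end MorseTile

/-- The union of the face sets of a list of Morse tiles. -/
def faceUnion (ts : List (MorseTile V)) : Finset (Finset V) :=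
  ts.foldr (fun T A => T.faceSet ∪ A) ∅

/-- A Morse tiling of the set `S` of nonempty faces of a relative complex:
the face sets of the tiles partition `S`, and for every `d` the union of the
face sets of the tiles of dimension at least `d` is closed in `S`. -/
def IsMorseTiling (S : Finset (Finset V)) (ts : List (MorseTile V)) : Prop :=
  ts.Pairwise (fun T T' => Disjoint T.faceSet T'.faceSet) ∧
  faceUnion ts = S ∧
  ∀ d : ℕ, closedIn S (faceUnion (ts.filter (fun T => decide (d ≤ T.dim))))

/-- A Morse shelling: a Morse tiling whose order makes every initial union closed. -/
def IsMorseShelling (S : Finset (Finset V)) (ts : List (MorseTile V)) : Prop :=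
  IsMorseTiling S ts ∧ ∀ p : ℕ, closedIn S (faceUnion (ts.take p))

/-- An h-tiling: a Morse tiling all of whose tiles are basic or critical. -/
def IsHTiling (S : Finset (Finset V)) (ts : List (MorseTile V)) : Prop :=
  IsMorseTiling S ts ∧ ∀ T ∈ ts, T.IsHTile

/-- A shellable (shelled) h-tiling. -/
def IsHShelling (S : Finset (Finset V)) (ts : List (MorseTile V)) : Prop :=
  IsMorseShelling S ts ∧ ∀ T ∈ ts, T.IsHTile

/-- The number of critical tiles of index `k`. -/
def criticalCount (ts : List (MorseTile V)) (k : ℕ) : ℕ :=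
  ts.countP (fun T => decide (T.IsCritical ∧ T.index = k))

/-- The total number of critical tiles. -/
def totalCritical (ts : List (MorseTile V)) : ℕ :=
  ts.countP (fun T => decide T.IsCritical)

/-- The number of tiles of order `k`. -/
def hCount (ts : List (MorseTile V)) (k : ℕ) : ℕ :=
  ts.countP (fun T => decide (T.order = k))

/-- The number of `k`-dimensional faces. -/
def fCount (S : Finset (Finset V)) (k : ℕ) : ℕ :=
  (S.filter (fun τ => τ.card = k + 1)).card

/-- The Euler characteristic of a set of nonempty faces. -/
def eulerChar (S : Finset (Finset V)) : ℤ :=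
  ∑ τ ∈ S, (-1 : ℤ) ^ (τ.card - 1)

/-- A pure `n`-dimensional complex: it has an `n`-dimensional face and all its
facets have dimension `n`. -/
def IsPureDim (n : ℕ) (K : Finset (Finset V)) : Prop :=
  (∃ σ ∈ K, σ.card = n + 1) ∧ ∀ θ, IsFacetOf K θ → θ.card = n + 1

/-- A closed `n`-dimensional pseudo-manifold: a pure `n`-dimensional complex in
which every `(n-1)`-dimensional face is contained in exactly two facets. -/
def IsPseudoManifold (n : ℕ) (K : Finset (Finset V)) : Prop :=
  IsComplex K ∧ IsPureDim n K ∧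
  ∀ ρ ∈ K, ρ.card = n → (K.filter (fun σ => IsFacetOf K σ ∧ ρ ⊆ σ)).card = 2

/-- Strong connectedness: any two facets are joined by a sequence of facets in which
consecutive ones share an `(n-1)`-dimensional face. -/
def StronglyConnected (n : ℕ) (K : Finset (Finset V)) : Prop :=
  ∀ σ σ', IsFacetOf K σ → IsFacetOf K σ' →
    ∃ (m : ℕ) (c : ℕ → Finset V), c 0 = σ ∧ c m = σ' ∧
      (∀ i ≤ m, IsFacetOf K (c i)) ∧
      ∀ i < m, ∃ ρ : Finset V, ρ.card = n ∧ ρ ⊆ c i ∧ ρ ⊆ c (i + 1)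

/-- Classical shellability of a finite simplicial complex. -/
def ClassicallyShellable (K : Finset (Finset V)) : Prop :=
  ∃ (N : ℕ) (f : Fin N → Finset V), Function.Injective f ∧
    (∀ σ, IsFacetOf K σ ↔ ∃ i, f i = σ) ∧
    ∀ p : Fin N, 0 < (p : ℕ) →
      ∃ R : Finset V, R ≠ ∅ ∧ R ⊆ f p ∧
        ∀ τ : Finset V,
          ((τ ≠ ∅ ∧ τ ⊆ f p ∧ ∀ q, q < p → ¬ τ ⊆ f q) ↔ (R ⊆ τ ∧ τ ⊆ f p))

/-- A top-dimensional simplex of a partial shelling: `res` collects the vertices opposite to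
the removed ridges, and every removed face of `simplex` not covered by those ridges lies in
`base`. -/
structure Cell (V : Type*) where
  simplex : Finset V
  res : Finset V
  base : Finset V

namespace Cell

/-- The cell over the ridge `b.simplex.erase x` in the cone with apex `w`, where the ridges
opposite to the vertices of `A` have already been covered. -/
def child (b : Cell V) (w : V) (A : Finset V) (x : V) : Cell V where
  simplex := insert w (b.simplex.erase x)
  res := if x ∈ b.res then insert w A else A
  base := b.base.erase x

/-- The cells obtained by coning the ridges of `b` opposite to the vertices of a list. -/
def children (b : Cell V) (w : V) : Finset V → List V → List (Cell V)
  | _, [] => []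
  | A, x :: xs => b.child w A x :: children b w (insert x A) xs

theorem length_children (b : Cell V) (w : V) (A : Finset V) (xs : List V) :
    (b.children w A xs).length = xs.length := by
  induction xs generalizing A with
  | nil => rfl
  | cons x xs ih => simp [children, ih]

theorem exists_split_of_mem_children {b c : Cell V} {w : V} {A : Finset V} {xs : List V}
    (hc : c ∈ b.children w A xs) :
    ∃ pre x post, xs = pre ++ x :: post ∧ c = b.child w (A ∪ pre.toFinset) x := by
  induction xs generalizing A with
  | nil => simp [children] at hc
  | cons x xs ih =>
    rcases List.mem_cons.1 hc with rfl | hc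
    · exact ⟨[], x, xs, rfl, by simp⟩
    · obtain ⟨pre, y, post, rfl, rfl⟩ := ih hc
      refine ⟨x :: pre, y, post, rfl, ?_⟩
      congr 1
      ext; simp

theorem exists_mem_children_subset_iff (b : Cell V) (w : V) (A : Finset V) (xs : List V)
    (τ : Finset V) :
    (∃ c ∈ b.children w A xs, τ ⊆ c.simplex) ↔ ∃ x ∈ xs, τ ⊆ insert w (b.simplex.erase x) := by
  induction xs generalizing A with
  | nil => simp [children]
  | cons x xs ih => simp [children, child, ih]

/-- A cell which is not yet a Morse tile. -/
def IsUnfinished (L : Finset (Finset V)) (b : Cell V) : Prop := b.res ∈ L ∧ b.base ∉ L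

/-- Compatibility of a cell with the removed subcomplex. -/
structure IsCompatible (n : ℕ) (L : Finset (Finset V)) (b : Cell V) : Prop where
  card_simplex : b.simplex.card = n + 1
  res_subset : b.res ⊆ b.simplex
  base_subset : b.base ⊆ b.simplex
  simplex_notMem : b.simplex ∉ L
  mem_res : ∀ x ∈ b.simplex, b.simplex.erase x ∈ L → x ∈ b.res
  subset_base : ∀ l ∈ L, l ⊆ b.simplex → l ⊆ b.base

open Classical in
/-- A weight decreasing when an unfinished cell is replaced by its children. -/
noncomputable def weight (n : ℕ) (L : Finset (Finset V)) (b : Cell V) : ℕ :=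
  if b.IsUnfinished L then (n + 2) ^ b.base.card else 0

/-- An enumeration of the vertices of a cell: first `res`, then `base`, then the others. -/
structure IsOrdering (b : Cell V) (xs : List V) : Prop where
  nodup : xs.Nodup
  mem_iff : ∀ x, x ∈ xs ↔ x ∈ b.simplex
  res_first : xs.Pairwise (fun x y => y ∈ b.res → x ∈ b.res)
  base_first : xs.Pairwise (fun x y => y ∈ b.base → x ∈ b.base)

theorem exists_isOrdering {b : Cell V} (hR : b.res ⊆ b.base) (hB : b.base ⊆ b.simplex) :
    ∃ xs, b.IsOrdering xs := by
  refine ⟨b.res.toList ++ ((b.base \ b.res).toList ++ (b.simplex \ b.base).toList), ?_, ?_, ?_, ?_⟩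
  · simp only [List.nodup_append, Finset.nodup_toList, true_and, Finset.mem_toList,
      List.mem_append, Finset.mem_sdiff]
    refine ⟨?_, ?_⟩
    · rintro a ⟨h1, -⟩ c ⟨-, h2⟩ rfl; exact h2 h1
    · rintro a h c (⟨-, h2⟩ | ⟨-, h2⟩) rfl
      · exact h2 h
      · exact h2 (hR h)
  · intro x
    have := @hR x
    have := @hB x
    simp only [List.mem_append, Finset.mem_toList, Finset.mem_sdiff]
    tauto
  · simp only [List.pairwise_append, Finset.mem_toList, List.mem_append, Finset.mem_sdiff]
    refine ⟨List.pairwise_of_forall_mem_list ?_,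
      ⟨List.pairwise_of_forall_mem_list ?_, List.pairwise_of_forall_mem_list ?_, ?_⟩, ?_⟩
    · simp; tauto
    · simp; tauto
    · simp only [Finset.mem_toList, Finset.mem_sdiff]
      intro x _ y hy h; exact absurd (hR h) hy.2
    · intro x _ y hy h; exact absurd (hR h) hy.2
    · tauto
  · simp only [List.pairwise_append, Finset.mem_toList, List.mem_append, Finset.mem_sdiff]
    refine ⟨List.pairwise_of_forall_mem_list ?_,
      ⟨List.pairwise_of_forall_mem_list ?_, List.pairwise_of_forall_mem_list ?_, ?_⟩, ?_⟩
    · simp only [Finset.mem_toList]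
      intro x hx y _ _; exact hR hx
    · simp; tauto
    · simp; tauto
    · tauto
    · intro x hx y _ _; exact hR hx

theorem subset_of_pairwise_of_notMem {B : Finset V} {pre post : List V} {x : V}
    (h : (pre ++ x :: post).Pairwise (fun x y => y ∈ B → x ∈ B))
    (hB : ∀ y ∈ B, y ∈ pre ++ x :: post) (hx : x ∉ B) : B ⊆ pre.toFinset := by
  intro y hy
  rw [List.pairwise_append, List.pairwise_cons] at h
  rcases List.mem_append.1 (hB y hy) with h1 | h1
  · simpa using h1
  · rcases List.mem_cons.1 h1 with rfl | h1
    · exact absurd hy hx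
    · exact absurd (h.2.1.1 y h1 hy) hx

namespace IsOrdering

variable {b : Cell V} {pre post : List V} {x : V}

theorem res_subset_of_notMem (h : b.IsOrdering (pre ++ x :: post)) (hR : b.res ⊆ b.simplex)
    (hx : x ∉ b.res) : b.res ⊆ pre.toFinset :=
  subset_of_pairwise_of_notMem h.res_first (fun y hy => (h.mem_iff y).2 (hR hy)) hx

theorem base_subset_of_notMem (h : b.IsOrdering (pre ++ x :: post)) (hB : b.base ⊆ b.simplex)
    (hx : x ∉ b.base) : b.base ⊆ pre.toFinset :=
  subset_of_pairwise_of_notMem h.base_first (fun y hy => (h.mem_iff y).2 (hB hy)) hx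

theorem toFinset_eq {xs : List V} (h : b.IsOrdering xs) : xs.toFinset = b.simplex := by
  ext; simp [h.mem_iff]

theorem length_eq {xs : List V} (h : b.IsOrdering xs) : xs.length = b.simplex.card := by
  rw [← h.toFinset_eq, List.toFinset_card_of_nodup h.nodup]

omit [DecidableEq V] in
theorem mem_simplex (h : b.IsOrdering (pre ++ x :: post)) : x ∈ b.simplex :=
  (h.mem_iff x).1 (by simp)

theorem toFinset_subset_erase (h : b.IsOrdering (pre ++ x :: post)) :
    pre.toFinset ⊆ b.simplex.erase x := by
  intro y hy
  rw [List.mem_toFinset] at hy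
  refine Finset.mem_erase.2 ⟨?_, (h.mem_iff y).1 (by simp [hy])⟩
  rintro rfl
  exact (List.nodup_append.1 h.nodup).2.2 y hy y (by simp) rfl

end IsOrdering

theorem isCompatible_child {n : ℕ} {L : Finset (Finset V)} {b : Cell V} {w : V}
    {pre post : List V} {x : V} (hb : b.IsCompatible n L) (hwb : w ∉ b.simplex)
    (hwL : ∀ l ∈ L, w ∉ l) (hxs : b.IsOrdering (pre ++ x :: post)) :
    (b.child w pre.toFinset x).IsCompatible n L where
  card_simplex := by
    have := Finset.card_erase_add_one hxs.mem_simplex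
    simp only [child]
    rw [Finset.card_insert_of_notMem (by simp [hwb]), this, hb.card_simplex]
  res_subset := by
    have h := hxs.toFinset_subset_erase
    simp only [child]
    split_ifs
    · exact Finset.insert_subset_insert _ h
    · exact h.trans (Finset.subset_insert _ _)
  base_subset :=
    (Finset.erase_subset_erase _ hb.base_subset).trans (Finset.subset_insert _ _)
  simplex_notMem h := hwL _ h (by simp [child])
  mem_res y hy h := by
    by_cases hyw : y = w
    · subst hyw
      simp only [child] at h ⊢
      rw [Finset.erase_insert (by simp [hwb])] at h
      simp [hb.mem_res x hxs.mem_simplex h]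
    · exact absurd (by simp [child, Ne.symm hyw]) (hwL _ h)
  subset_base l hl h := by
    have hwl := hwL l hl
    have h1 : l ⊆ b.simplex.erase x := (Finset.subset_insert_iff_of_notMem hwl).1 h
    have h2 := hb.subset_base l hl (h1.trans (Finset.erase_subset _ _))
    exact Finset.subset_erase.2 ⟨h2, fun hx => by simpa using h1 hx⟩

theorem weight_child_le {n : ℕ} {L : Finset (Finset V)} (hL : IsComplex L) {b : Cell V} {w : V}
    {pre post : List V} {x : V} (hb : b.IsCompatible n L) (hu : b.IsUnfinished L)
    (hxs : b.IsOrdering (pre ++ x :: post)) :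
    (b.child w pre.toFinset x).weight n L ≤ (n + 2) ^ (b.base.card - 1) := by
  unfold weight
  split_ifs with h
  · by_cases hx : x ∈ b.base
    · simp [child, Finset.card_erase_of_mem hx]
    · refine absurd (hL _ h.1 _ ?_) hu.2
      refine (hxs.base_subset_of_notMem hb.base_subset hx).trans ?_
      simp only [child]
      split_ifs
      · exact Finset.subset_insert _ _
      · exact subset_rfl
  · exact Nat.zero_le _

theorem sum_weight_children_lt {n : ℕ} {L : Finset (Finset V)} (hL : IsComplex L) {b : Cell V}
    {w : V} {xs : List V} (hb : b.IsCompatible n L) (hu : b.IsUnfinished L)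
    (hxs : b.IsOrdering xs) :
    ((b.children w ∅ xs).map (weight n L)).sum < b.weight n L := by
  have h1 : ((b.children w ∅ xs).map (weight n L)).sum ≤
      ((b.children w ∅ xs).map (weight n L)).length • (n + 2) ^ (b.base.card - 1) := by
    apply List.sum_le_card_nsmul
    intro k hk
    obtain ⟨c, hc, rfl⟩ := List.mem_map.1 hk
    obtain ⟨pre, x, post, rfl, rfl⟩ := exists_split_of_mem_children hc
    simpa using weight_child_le hL hb hu hxs
  have hpos : b.base.card ≠ 0 := by
    intro h0
    have h0 := Finset.card_eq_zero.1 h0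
    exact hu.2 (hL _ hu.1 _ (by simp [h0]))
  rw [List.length_map, length_children, hxs.length_eq, hb.card_simplex, smul_eq_mul] at h1
  rw [weight, if_pos hu]
  obtain ⟨k, hk⟩ := Nat.exists_eq_succ_of_ne_zero hpos
  rw [hk] at h1 ⊢
  simp only [Nat.succ_eq_add_one, Nat.add_sub_cancel] at h1
  have : 0 < (n + 2) ^ k := by positivity
  rw [Nat.succ_eq_add_one, pow_succ]
  nlinarith

theorem countP_res_eq_empty_children {b : Cell V} {w : V} {xs : List V}
    (hR : b.res ⊆ b.simplex) (hne : b.simplex.Nonempty) (hxs : b.IsOrdering xs) :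
    (b.children w ∅ xs).countP (fun c => decide (c.res = ∅)) = if b.res = ∅ then 1 else 0 := by
  cases xs with
  | nil =>
    obtain ⟨y, hy⟩ := hne
    simpa using (hxs.mem_iff y).2 hy
  | cons x xs =>
    have h0 : (b.children w (insert x ∅) xs).countP (fun c => decide (c.res = ∅)) = 0 := by
      rw [List.countP_eq_zero]
      intro c hc
      obtain ⟨pre, y, post, rfl, rfl⟩ := exists_split_of_mem_children hc
      rw [decide_eq_true_eq]
      refine Finset.ne_empty_of_mem (a := x) ?_
      simp only [child]
      split_ifs <;> simp
    rw [children, List.countP_cons, h0]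
    have h1 := hxs.res_subset_of_notMem (pre := []) hR
    by_cases hx : x ∈ b.res
    · simp [child, hx, Finset.ne_empty_of_mem hx]
    · simp only [List.toFinset_nil, Finset.subset_empty] at h1
      simp [child, h1 hx]

theorem countP_res_eq_simplex_children {b : Cell V} {w : V} {pre xs : List V}
    (hR : b.res ⊆ b.simplex) (hwb : w ∉ b.simplex) (hne : xs ≠ [])
    (hxs : b.IsOrdering (pre ++ xs)) :
    (b.children w pre.toFinset xs).countP (fun c => decide (c.res = c.simplex)) =
      if b.res = b.simplex then 1 else 0 := by
  induction xs generalizing pre with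
  | nil => exact absurd rfl hne
  | cons x xs ih =>
    have hsub := hxs.toFinset_subset_erase
    have hwpre : w ∉ pre.toFinset := fun h => hwb (Finset.mem_of_mem_erase (hsub h))
    have hiff : (b.child w pre.toFinset x).res = (b.child w pre.toFinset x).simplex ↔
        x ∈ b.res ∧ pre.toFinset = b.simplex.erase x := by
      simp only [child]
      split_ifs with hx
      · simp only [hx, true_and]
        refine ⟨fun h => ?_, fun h => by rw [h]⟩
        rw [← Finset.erase_insert hwpre, h, Finset.erase_insert (by simp [hwb])]
      · simp only [hx, false_and, iff_false]
        exact fun h => hwpre (h ▸ Finset.mem_insert_self _ _)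
    rw [children, List.countP_cons]
    simp only [decide_eq_true_eq, hiff]
    by_cases hnil : xs = []
    · subst hnil
      have hpre : pre.toFinset = b.simplex.erase x := by
        refine hsub.antisymm fun y hy => ?_
        have := (hxs.mem_iff y).2 (Finset.mem_of_mem_erase hy)
        have h2 := Finset.ne_of_mem_erase hy
        simpa [h2] using this
      simp only [children, List.countP_nil, hpre, and_true, zero_add]
      congr 1
      refine propext ⟨fun hx => hR.antisymm fun y hy => ?_, fun h => h ▸ hxs.mem_simplex⟩
      by_cases hyx : y = x
      · exact hyx ▸ hx
      · have hy' : y ∈ pre := by simpa [hyx] using (hxs.mem_iff y).2 hy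
        exact (List.pairwise_append.1 hxs.res_first).2.2 y hy' x (by simp) hx
    · have hpre : pre.toFinset ≠ b.simplex.erase x := by
        intro h
        obtain ⟨y, ys, rfl⟩ := List.exists_cons_of_ne_nil hnil
        have hnd := hxs.nodup
        have hy : y ∈ pre.toFinset := by
          rw [h, Finset.mem_erase, ← hxs.mem_iff]
          refine ⟨?_, by simp⟩
          rintro rfl
          simp [List.nodup_append] at hnd
        rw [List.mem_toFinset] at hy
        exact (List.nodup_append.1 hnd).2.2 y hy y (by simp) rfl
      have hins : insert x pre.toFinset = (pre ++ [x]).toFinset := by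
        ext; simp
      rw [hins, ih hnil (by simpa using hxs)]
      simp [hpre]

end Cell

/-- A list of cells is shelled, relatively to a property `P` of faces already covered, when
the faces of `S` in each cell which contain its restriction set are those not covered before. -/
def IsShelled (S : Finset (Finset V)) : (Finset V → Prop) → List (Cell V) → Prop
  | _, [] => True
  | P, b :: bs => (∀ τ ∈ S, τ ⊆ b.simplex → (b.res ⊆ τ ↔ ¬ P τ)) ∧
      IsShelled S (fun τ => P τ ∨ τ ⊆ b.simplex) bs

namespace IsShelled

variable {S : Finset (Finset V)} {P : Finset V → Prop}

omit [DecidableEq V] in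
theorem congr {S' : Finset (Finset V)} {P' : Finset V → Prop} {bs : List (Cell V)}
    (h : IsShelled S P bs)
    (hS : ∀ τ ∈ S', ∀ b ∈ bs, τ ⊆ b.simplex → τ ∈ S ∧ (P τ ↔ P' τ)) :
    IsShelled S' P' bs := by
  induction bs generalizing P P' with
  | nil => trivial
  | cons b bs ih =>
    refine ⟨fun τ hτ hb => ?_, ih h.2 fun τ hτ c hc hτc => ?_⟩
    · obtain ⟨h1, h2⟩ := hS τ hτ b (by simp) hb
      rw [← h2]
      exact h.1 τ h1 hb
    · obtain ⟨h1, h2⟩ := hS τ hτ c (by simp [hc]) hτc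
      exact ⟨h1, by rw [h2]⟩

omit [DecidableEq V] in
theorem append_iff {l₁ l₂ : List (Cell V)} :
    IsShelled S P (l₁ ++ l₂) ↔ IsShelled S P l₁ ∧
      IsShelled S (fun τ => P τ ∨ ∃ b ∈ l₁, τ ⊆ b.simplex) l₂ := by
  induction l₁ generalizing P with
  | nil => simp [IsShelled]
  | cons b l₁ ih =>
    simp only [List.cons_append, IsShelled, ih, and_assoc, List.exists_mem_cons_iff, or_assoc]

omit [DecidableEq V] in
theorem not_of_mem {bs : List (Cell V)} (h : IsShelled S P bs) {b : Cell V} (hb : b ∈ bs)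
    {τ : Finset V} (hτ : τ ∈ S) (hτb : τ ⊆ b.simplex) (hres : b.res ⊆ τ) : ¬ P τ := by
  induction bs generalizing P with
  | nil => simp at hb
  | cons c bs ih =>
    rcases List.mem_cons.1 hb with rfl | hb
    · exact (h.1 τ hτ hτb).1 hres
    · exact fun hP => ih h.2 hb (Or.inl hP)

theorem exists_of_subset {bs : List (Cell V)} (h : IsShelled S P bs) {b : Cell V} (hb : b ∈ bs)
    {τ : Finset V} (hτ : τ ∈ S) (hτb : τ ⊆ b.simplex) (hP : ¬ P τ) :
    ∃ c ∈ bs, c.res ⊆ τ ∧ τ ⊆ c.simplex := by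
  induction bs generalizing P with
  | nil => simp at hb
  | cons c bs ih =>
    by_cases hc : τ ⊆ c.simplex
    · exact ⟨c, by simp, (h.1 τ hτ hc).2 hP, hc⟩
    · rcases List.mem_cons.1 hb with rfl | hb
      · exact absurd hτb hc
      · obtain ⟨d, hd, h'⟩ := ih h.2 hb (by simp [hP, hc])
        exact ⟨d, by simp [hd], h'⟩

omit [DecidableEq V] in
theorem pairwise {bs : List (Cell V)} (h : IsShelled S P bs) :
    bs.Pairwise fun b c => ∀ τ ∈ S, τ ⊆ b.simplex → τ ⊆ c.simplex → ¬ c.res ⊆ τ := by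
  induction bs generalizing P with
  | nil => exact List.Pairwise.nil
  | cons b bs ih =>
    refine List.Pairwise.cons (fun c hc τ hτ hb hτc hres => ?_) (ih h.2)
    exact h.2.not_of_mem hc hτ hτc hres (Or.inr hb)

theorem children {b : Cell V} {w : V} {pre xs : List V} (hR : b.res ⊆ b.simplex)
    (hwb : w ∉ b.simplex) (hxs : b.IsOrdering (pre ++ xs))
    (hw : ∀ τ, w ∈ τ → ¬ P τ)
    (hP : ∀ τ ∈ S, w ∉ τ → τ ⊆ b.simplex → (b.res ⊆ τ ↔ ¬ P τ)) :
    IsShelled S (fun τ => P τ ∨ ∃ x ∈ pre, τ ⊆ insert w (b.simplex.erase x))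
      (b.children w pre.toFinset xs) := by
  induction xs generalizing pre with
  | nil => trivial
  | cons x xs ih =>
    have hsub := hxs.toFinset_subset_erase
    refine ⟨fun τ hτ hτx => ?_, ?_⟩
    · simp only [Cell.child] at hτx ⊢
      have hpre : (¬ ∃ y ∈ pre, τ ⊆ insert w (b.simplex.erase y)) ↔ pre.toFinset ⊆ τ := by
        push Not
        constructor
        · intro h y hy
          by_contra hyτ
          refine h y (by simpa using hy) fun z hz => ?_
          have hz' := hτx hz
          simp only [Finset.mem_insert, Finset.mem_erase] at hz' ⊢
          refine hz'.imp_right fun h => ⟨?_, h.2⟩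
          rintro rfl
          exact hyτ hz
        · intro h y hy hτy
          have hy' : y ∈ pre.toFinset := by simpa using hy
          have := hτy (h hy')
          have hyF := Finset.mem_of_mem_erase (hsub hy')
          simp only [Finset.mem_insert, Finset.mem_erase] at this
          rcases this with rfl | h
          · exact hwb hyF
          · exact h.1 rfl
      rw [not_or, hpre]
      by_cases hwτ : w ∈ τ
      · simp only [hw τ hwτ, not_false_eq_true, true_and]
        split_ifs
        · simp [Finset.insert_subset_iff, hwτ]
        · rfl
      · have hτF : τ ⊆ b.simplex.erase x := (Finset.subset_insert_iff_of_notMem hwτ).1 hτx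
        rw [← hP τ hτ hwτ (hτF.trans (Finset.erase_subset _ _))]
        split_ifs with hx
        · have : ¬ b.res ⊆ τ := fun h => by simpa using hτF (h hx)
          simp [Finset.insert_subset_iff, hwτ, this]
        · have := hxs.res_subset_of_notMem hR hx
          exact ⟨fun h => ⟨this.trans h, h⟩, fun h => h.2⟩
    · have hins : insert x pre.toFinset = (pre ++ [x]).toFinset := by
        ext; simp
      have := ih (pre := pre ++ [x]) (by simpa using hxs)
      rw [hins]
      refine this.congr fun τ hτ _ _ _ => ⟨hτ, ?_⟩
      simp only [List.mem_append, List.mem_singleton, Cell.child]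
      constructor
      · rintro (h | ⟨y, hy | rfl, h⟩)
        · exact Or.inl (Or.inl h)
        · exact Or.inl (Or.inr ⟨y, hy, h⟩)
        · exact Or.inr h
      · rintro ((h | ⟨y, hy, h⟩) | h)
        · exact Or.inl h
        · exact Or.inr ⟨y, Or.inl hy, h⟩
        · exact Or.inr ⟨x, Or.inr rfl, h⟩

end IsShelled

theorem mem_stellar_iff_of_maximal {K : Finset (Finset V)} (hK : IsComplex K) {F : Finset V}
    (hF : F ∈ K) (hmax : ∀ τ ∈ K, F ⊆ τ → τ = F) {w : V} {τ : Finset V} :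
    τ ∈ stellar K F w ↔ (τ ∈ K ∧ τ ≠ F) ∨ ∃ ρ, ρ ⊂ F ∧ τ = insert w ρ := by
  simp only [stellar, Finset.mem_union, Finset.mem_filter, Finset.mem_image]
  refine or_congr (and_congr_right fun h => not_congr ⟨hmax τ h, fun h => h.ge⟩) ?_
  constructor
  · rintro ⟨ρ, ⟨-, h1, h2⟩, rfl⟩
    have := hmax _ h2 Finset.subset_union_right
    exact ⟨ρ, ⟨Finset.union_eq_right.1 this, h1⟩, rfl⟩
  · rintro ⟨ρ, h, rfl⟩
    refine ⟨ρ, ⟨hK F hF ρ h.1, h.2, ?_⟩, rfl⟩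
    rwa [Finset.union_eq_right.2 h.1]

theorem stellar_eq_self {L : Finset (Finset V)} (hL : IsComplex L) {θ : Finset V} (hθ : θ ∉ L)
    (v : V) : stellar L θ v = L := by
  have h1 : L.filter (fun ρ => ¬ θ ⊆ ρ ∧ ρ ∪ θ ∈ L) = ∅ :=
    Finset.filter_eq_empty_iff.2 fun ρ _ h => hθ (hL _ h.2 _ Finset.subset_union_right)
  rw [stellar, h1, Finset.image_empty, Finset.union_empty, Finset.filter_eq_self]
  exact fun τ hτ h => hθ (hL _ hτ _ h)

theorem IsComplex.stellar_of_maximal {K : Finset (Finset V)} (hK : IsComplex K) {F : Finset V}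
    (hF : F ∈ K) (hmax : ∀ τ ∈ K, F ⊆ τ → τ = F) (w : V) :
    IsComplex (stellar K F w) := by
  intro τ hτ τ' hsub
  rw [mem_stellar_iff_of_maximal hK hF hmax] at hτ ⊢
  rcases hτ with ⟨h1, h2⟩ | ⟨ρ, hρ, rfl⟩
  · exact Or.inl ⟨hK _ h1 _ hsub, fun h => h2 (hmax _ h1 (h ▸ hsub))⟩
  · by_cases hw : w ∈ τ'
    · refine Or.inr ⟨τ'.erase w, ?_, (Finset.insert_erase hw).symm⟩
      exact lt_of_le_of_lt (Finset.subset_insert_iff.1 hsub) hρ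
    · have h := (Finset.subset_insert_iff_of_notMem hw).1 hsub
      have h' : τ' ⊂ F := lt_of_le_of_lt h hρ
      exact Or.inl ⟨hK _ hF _ h'.1, h'.ne⟩

theorem mem_relFaces {K L : Finset (Finset V)} {τ : Finset V} :
    τ ∈ relFaces K L ↔ τ ∈ K ∧ τ ∉ L ∧ τ ≠ ∅ := by
  simp [relFaces, and_assoc]

/-- A shelled decomposition of the relative complex `K ∖ L` into cells, with `a` cells of
order `0` and `o` open cells. -/
structure IsCellShelling (n : ℕ) (L : Finset (Finset V)) (a o : ℕ) (K : Finset (Finset V))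
    (bs : List (Cell V)) : Prop where
  isComplex : IsComplex K
  subset : L ⊆ K
  compatible : ∀ b ∈ bs, b.IsCompatible n L
  mem : ∀ b ∈ bs, b.simplex ∈ K
  cover : ∀ τ ∈ K, ∃ b ∈ bs, τ ⊆ b.simplex
  shelled : IsShelled (relFaces K L) (fun _ => False) bs
  count_zero : bs.countP (fun c => decide (c.res = ∅)) = a
  count_open : bs.countP (fun c => decide (c.res = c.simplex)) = o

namespace IsCellShelling

variable {n a o : ℕ} {L K : Finset (Finset V)}

theorem maximal {bs : List (Cell V)} (h : IsCellShelling n L a o K bs) {b : Cell V} (hb : b ∈ bs)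
    {τ : Finset V} (hτ : τ ∈ K) (hbτ : b.simplex ⊆ τ) : τ = b.simplex := by
  obtain ⟨c, hc, hτc⟩ := h.cover τ hτ
  refine (Finset.eq_of_subset_of_card_le hbτ ?_).symm
  rw [(h.compatible b hb).card_simplex, ← (h.compatible c hc).card_simplex]
  exact Finset.card_le_card hτc

theorem isFacetOf {bs : List (Cell V)} (h : IsCellShelling n L a o K bs) {b : Cell V}
    (hb : b ∈ bs) : IsFacetOf (relFaces K L) b.simplex := by
  refine ⟨mem_relFaces.2 ⟨h.mem b hb, (h.compatible b hb).simplex_notMem, ?_⟩,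
    fun τ hτ => h.maximal hb (mem_relFaces.1 hτ).1⟩
  rw [← Finset.card_pos.trans Finset.nonempty_iff_ne_empty, (h.compatible b hb).card_simplex]
  exact n.succ_pos

theorem stellar {pre post : List (Cell V)} {b : Cell V}
    (h : IsCellShelling n L a o K (pre ++ b :: post)) {w : V} (hw : ∀ τ ∈ K, w ∉ τ)
    {xs : List V} (hxs : b.IsOrdering xs) :
    IsCellShelling n L a o (stellar K b.simplex w) (pre ++ (b.children w ∅ xs ++ post)) := by
  have hbmem : b ∈ pre ++ b :: post := by simp
  have hb := h.compatible b hbmem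
  have hbK := h.mem b hbmem
  have hwb : w ∉ b.simplex := hw _ hbK
  have hne : b.simplex.Nonempty := Finset.card_pos.1 (by rw [hb.card_simplex]; exact n.succ_pos)
  have hmem : ∀ {τ}, τ ∈ _root_.stellar K b.simplex w ↔
      (τ ∈ K ∧ τ ≠ b.simplex) ∨ ∃ ρ, ρ ⊂ b.simplex ∧ τ = insert w ρ :=
    mem_stellar_iff_of_maximal h.isComplex hbK (fun τ hτ => h.maximal hbmem hτ)
  have hold : ∀ τ ∈ _root_.stellar K b.simplex w, w ∉ τ → τ ∈ K ∧ τ ≠ b.simplex := by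
    intro τ hτ hwτ
    rcases hmem.1 hτ with h | ⟨ρ, -, rfl⟩
    · exact h
    · simp at hwτ
  have hrel : ∀ τ ∈ relFaces (_root_.stellar K b.simplex w) L, w ∉ τ → τ ∈ relFaces K L := by
    intro τ hτ hwτ
    rw [mem_relFaces] at hτ ⊢
    exact ⟨(hold τ hτ.1 hwτ).1, hτ.2⟩
  have hmiss : ∀ ρ : Finset V, ρ ⊂ b.simplex → ∃ x ∈ xs, ρ ⊆ b.simplex.erase x := by
    intro ρ hρ
    obtain ⟨x, hx, hxρ⟩ := Finset.exists_of_ssubset hρ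
    exact ⟨x, (hxs.mem_iff x).2 hx, Finset.subset_erase.2 ⟨hρ.1, hxρ⟩⟩
  have hnodup : ∀ c ∈ pre ++ post, w ∉ c.simplex ∧ c.simplex ≠ b.simplex := by
    intro c hc
    have hc' : c ∈ pre ++ b :: post := by
      simp only [List.mem_append, List.mem_cons] at hc ⊢; tauto
    refine ⟨hw _ (h.mem c hc'), fun heq => ?_⟩
    have hS := (h.isFacetOf hbmem).1
    have hp := h.shelled.pairwise
    rw [List.pairwise_append, List.pairwise_cons] at hp
    rcases List.mem_append.1 hc with hc | hc
    · exact hp.2.2 c hc b (by simp) _ hS heq.ge subset_rfl hb.res_subset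
    · exact hp.2.1.1 c hc _ hS subset_rfl heq.ge
        (heq ▸ (h.compatible c hc').res_subset)
  obtain ⟨hpre, hbsh, hpost⟩ := IsShelled.append_iff.1 h.shelled
  constructor
  · exact h.isComplex.stellar_of_maximal hbK (fun τ hτ => h.maximal hbmem hτ) w
  · exact fun l hl => hmem.2 (Or.inl ⟨h.subset hl, fun heq => hb.simplex_notMem (heq ▸ hl)⟩)
  · intro c hc
    simp only [List.mem_append] at hc
    rcases hc with hc | hc | hc
    · exact h.compatible c (by simp [hc])
    · obtain ⟨p, x, q, rfl, rfl⟩ := Cell.exists_split_of_mem_children hc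
      rw [Finset.empty_union]
      exact Cell.isCompatible_child hb hwb (fun l hl => hw l (h.subset hl)) hxs
    · exact h.compatible c (by simp [hc])
  · intro c hc
    simp only [List.mem_append] at hc
    rcases hc with hc | hc | hc
    · exact hmem.2 (Or.inl ⟨h.mem c (by simp [hc]), (hnodup c (by simp [hc])).2⟩)
    · obtain ⟨p, x, q, rfl, rfl⟩ := Cell.exists_split_of_mem_children hc
      exact hmem.2 (Or.inr ⟨_, Finset.erase_ssubset hxs.mem_simplex, rfl⟩)
    · exact hmem.2 (Or.inl ⟨h.mem c (by simp [hc]), (hnodup c (by simp [hc])).2⟩)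
  · intro τ hτ
    have hchild : (∃ x ∈ xs, τ ⊆ insert w (b.simplex.erase x)) →
        ∃ c ∈ pre ++ (b.children w ∅ xs ++ post), τ ⊆ c.simplex := by
      intro hx
      obtain ⟨c, hc, hτc⟩ := (b.exists_mem_children_subset_iff w ∅ xs τ).2 hx
      exact ⟨c, by simp [hc], hτc⟩
    rcases hmem.1 hτ with ⟨hτK, hτb⟩ | ⟨ρ, hρ, rfl⟩
    · obtain ⟨c, hc, hτc⟩ := h.cover τ hτK
      simp only [List.mem_append, List.mem_cons] at hc
      rcases hc with hc | rfl | hc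
      · exact ⟨c, by simp [hc], hτc⟩
      · obtain ⟨x, hx, hτx⟩ := hmiss τ (hτc.ssubset_of_ne hτb)
        exact hchild ⟨x, hx, hτx.trans (Finset.subset_insert _ _)⟩
      · exact ⟨c, by simp [hc], hτc⟩
    · obtain ⟨x, hx, hτx⟩ := hmiss ρ hρ
      exact hchild ⟨x, hx, Finset.insert_subset_insert _ hτx⟩
  · rw [IsShelled.append_iff, IsShelled.append_iff]
    refine ⟨hpre.congr fun τ hτ c hc hτc => ⟨hrel τ hτ ?_, Iff.rfl⟩, ?_, hpost.congr ?_⟩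
    · exact fun hwτ => (hnodup c (by simp [hc])).1 (hτc hwτ)
    · have := IsShelled.children (S := relFaces (_root_.stellar K b.simplex w) L)
        (P := fun τ => False ∨ ∃ c ∈ pre, τ ⊆ c.simplex) (pre := []) hb.res_subset hwb hxs
        (by
          rintro τ hwτ (h | ⟨c, hc, hτc⟩)
          · exact h
          · exact (hnodup c (by simp [hc])).1 (hτc hwτ))
        (fun τ hτ hwτ hτb => hbsh τ (hrel τ hτ hwτ) hτb)
      refine this.congr fun τ hτ _ _ _ => ⟨hτ, ?_⟩
      simp
    · intro τ hτ c hc hτc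
      have hwτ : w ∉ τ := fun hwτ => (hnodup c (by simp [hc])).1 (hτc hwτ)
      refine ⟨hrel τ hτ hwτ, or_congr_right ?_⟩
      rw [Cell.exists_mem_children_subset_iff]
      constructor
      · intro hτb
        obtain ⟨x, hx, hτx⟩ :=
          hmiss τ (hτb.ssubset_of_ne (hold τ (mem_relFaces.1 hτ).1 hwτ).2)
        exact ⟨x, hx, hτx.trans (Finset.subset_insert _ _)⟩
      · rintro ⟨x, -, hτx⟩
        exact ((Finset.subset_insert_iff_of_notMem hwτ).1 hτx).trans (Finset.erase_subset _ _)
  · rw [← h.count_zero]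
    simp only [List.countP_append, List.countP_cons,
      Cell.countP_res_eq_empty_children hb.res_subset hne hxs, decide_eq_true_eq]
    omega
  · rw [← h.count_open]
    have hxne : xs ≠ [] := by
      rintro rfl
      obtain ⟨y, hy⟩ := hne
      simpa using (hxs.mem_iff y).2 hy
    have := Cell.countP_res_eq_simplex_children (pre := []) hb.res_subset hwb hxne hxs
    rw [List.toFinset_nil] at this
    simp only [List.countP_append, List.countP_cons, this, decide_eq_true_eq]
    omega

theorem exists_finished [Infinite V] (hL : IsComplex L) {bs : List (Cell V)}
    (h : IsCellShelling n L a o K bs) :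
    ∃ (N : ℕ) (C : ℕ → Finset (Finset V)) (θ : ℕ → Finset V) (v : ℕ → V),
      C 0 = K ∧
      (∀ i < N, IsFacetOf (relFaces (C i) L) (θ i) ∧ (∀ τ ∈ C i, v i ∉ τ) ∧
        C (i + 1) = _root_.stellar (C i) (θ i) (v i) ∧ θ i ∉ L) ∧
      ∃ bs', IsCellShelling n L a o (C N) bs' ∧ ∀ b ∈ bs', ¬ b.IsUnfinished L := by
  induction hm : (bs.map (Cell.weight n L)).sum using Nat.strong_induction_on
    generalizing K bs with
  | _ m ih =>
    by_cases hfin : ∀ b ∈ bs, ¬ b.IsUnfinished L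
    · exact ⟨0, fun _ => K, fun _ => ∅, fun _ => Classical.arbitrary V, rfl, by simp, bs, h, hfin⟩
    · push Not at hfin
      obtain ⟨b, hbmem, hu⟩ := hfin
      obtain ⟨pre, post, rfl⟩ := List.append_of_mem hbmem
      have hb := h.compatible b hbmem
      obtain ⟨w, hw⟩ := Infinite.exists_notMem_finset (K.biUnion id)
      have hw' : ∀ τ ∈ K, w ∉ τ := fun τ hτ hwτ => hw (Finset.mem_biUnion.2 ⟨τ, hτ, hwτ⟩)
      obtain ⟨xs, hxs⟩ := Cell.exists_isOrdering
        (hb.subset_base _ hu.1 hb.res_subset) hb.base_subset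
      have hlt := Cell.sum_weight_children_lt (w := w) hL hb hu hxs
      obtain ⟨N, C, θ, v, hC, hstep, hend⟩ := ih _ (by
        rw [← hm]
        simp only [List.map_append, List.sum_append, List.map_cons, List.sum_cons]
        omega) (h.stellar hw' hxs) rfl
      refine ⟨N + 1, fun i => Nat.casesOn i K C, fun i => Nat.casesOn i b.simplex θ,
        fun i => Nat.casesOn i w v, rfl, ?_, hend⟩
      rintro (_ | i) hi
      · exact ⟨h.isFacetOf hbmem, hw', hC, hb.simplex_notMem⟩
      · exact hstep i (by omega)

end IsCellShelling

theorem isCellShelling_powerset {n : ℕ} {σ : Finset V} (hσ : σ.card = n + 1)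
    {L : Finset (Finset V)} (hL : IsComplex L) (hLσ : L ⊆ σ.powerset) (hLp : σ ∉ L) :
    IsCellShelling n L (if ∀ ρ ⊆ σ, ρ.card = n → ρ ∉ L then 1 else 0)
      (if ∀ ρ ⊆ σ, ρ.card = n → ρ ∈ L then 1 else 0) σ.powerset
      [⟨σ, σ.filter (fun x => σ.erase x ∈ L), σ⟩] := by
  have hridge : ∀ ρ ⊆ σ, ρ.card = n → ∃ x ∈ σ, ρ = σ.erase x := by
    intro ρ hρ hc
    obtain ⟨x, hx, hxρ⟩ := Finset.exists_of_ssubset (s₁ := ρ) (s₂ := σ)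
      (hρ.ssubset_of_ne (by rintro rfl; omega))
    refine ⟨x, hx, Finset.eq_of_subset_of_card_le (Finset.subset_erase.2 ⟨hρ, hxρ⟩) ?_⟩
    rw [Finset.card_erase_of_mem hx]
    omega
  have hcard : ∀ x ∈ σ, (σ.erase x).card = n := fun x hx => by
    rw [Finset.card_erase_of_mem hx]; omega
  constructor
  · intro τ hτ τ' h
    exact Finset.mem_powerset.2 (h.trans (Finset.mem_powerset.1 hτ))
  · exact hLσ
  · simp only [List.mem_singleton, forall_eq]
    exact ⟨hσ, Finset.filter_subset _ _, subset_rfl, hLp, fun x hx h => by simp [hx, h],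
      fun l hl _ => Finset.mem_powerset.1 (hLσ hl)⟩
  · simp
  · simp
  · refine ⟨fun τ hτ hτσ => ?_, trivial⟩
    simp only [not_false_eq_true, iff_true]
    intro x hx
    by_contra hxτ
    exact (mem_relFaces.1 hτ).2.1
      (hL _ (Finset.mem_filter.1 hx).2 _ (Finset.subset_erase.2 ⟨hτσ, hxτ⟩))
  · simp only [List.countP_singleton, decide_eq_true_eq]
    congr 1
    rw [Finset.filter_eq_empty_iff]
    refine propext ⟨fun h ρ hρ hc => ?_, fun h x hx => h _ (Finset.erase_subset _ _) (hcard x hx)⟩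
    obtain ⟨x, hx, rfl⟩ := hridge ρ hρ hc
    exact h hx
  · simp only [List.countP_singleton, decide_eq_true_eq]
    congr 1
    rw [Finset.filter_eq_self]
    refine propext ⟨fun h ρ hρ hc => ?_, fun h x hx => h _ (Finset.erase_subset _ _) (hcard x hx)⟩
    obtain ⟨x, hx, rfl⟩ := hridge ρ hρ hc
    exact h x hx

theorem mem_faceUnion {ts : List (MorseTile V)} {τ : Finset V} :
    τ ∈ faceUnion ts ↔ ∃ T ∈ ts, τ ∈ T.faceSet := by
  induction ts with
  | nil => simp [faceUnion]
  | cons T ts ih =>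
    have : faceUnion (T :: ts) = T.faceSet ∪ faceUnion ts := rfl
    rw [this, Finset.mem_union, ih, List.exists_mem_cons_iff]

theorem Cell.IsCompatible.exists_morseTile {n : ℕ} {L : Finset (Finset V)} (hL : IsComplex L)
    {b : Cell V} (hb : b.IsCompatible n L) (hfin : ¬ b.IsUnfinished L) :
    ∃ T : MorseTile V, T.simplex = b.simplex ∧ T.res = b.res ∧
      (T.IsOpenSimplex ↔ b.res = b.simplex) ∧
      ∀ τ, τ ∈ T.faceSet ↔ τ ⊆ b.simplex ∧ b.res ⊆ τ ∧ τ ∉ L ∧ τ ≠ ∅ := by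
  have hne : b.simplex.Nonempty := Finset.card_pos.1 (by rw [hb.card_simplex]; exact n.succ_pos)
  by_cases hR : b.res ∈ L
  · have hbase : b.base ∈ L := by
      by_contra h
      exact hfin ⟨hR, h⟩
    have hsub : b.res ⊆ b.base := hb.subset_base _ hR hb.res_subset
    have hss : b.base ⊂ b.simplex :=
      hb.base_subset.ssubset_of_ne fun h => hb.simplex_notMem (h ▸ hbase)
    have hcard : b.base.card + 2 ≤ b.simplex.card := by
      by_contra hlt
      have h1 := Finset.card_lt_card hss
      obtain ⟨x, hx, hxb⟩ := Finset.exists_of_ssubset hss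
      have heq : b.base = b.simplex.erase x := by
        refine Finset.eq_of_subset_of_card_le (Finset.subset_erase.2 ⟨hss.1, hxb⟩) ?_
        rw [Finset.card_erase_of_mem hx]
        omega
      exact hxb (hsub (hb.mem_res x hx (heq ▸ hbase)))
    refine ⟨⟨b.simplex, b.res, some b.base, hne, hb.res_subset, ?_, ?_, ?_⟩, rfl, rfl, ?_, ?_⟩
    · simpa using hsub
    · simpa using hss
    · simpa using hcard
    · simp only [MorseTile.IsOpenSimplex, reduceCtorEq, false_and, false_iff]
      exact fun h => hb.simplex_notMem (h ▸ hR)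
    · intro τ
      simp only [MorseTile.faceSet, Finset.mem_filter, Finset.mem_powerset]
      refine and_congr_right fun hτ => and_congr_right fun _ => ⟨fun h => ⟨?_, ?_⟩, fun h h' => ?_⟩
      · exact fun hτL => h (hb.subset_base _ hτL hτ)
      · rintro rfl
        exact h (Finset.empty_subset _)
      · exact h.1 (hL _ hbase _ h')
  · refine ⟨⟨b.simplex, b.res, none, hne, hb.res_subset, by simp, by simp, by simp⟩, rfl, rfl,
      by simp [MorseTile.IsOpenSimplex], fun τ => ?_⟩
    simp only [MorseTile.faceSet, Finset.mem_filter, Finset.mem_powerset]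
    refine and_congr_right fun _ => and_congr_right fun h => ⟨fun h' => ⟨?_, h'⟩, fun h' => h'.2⟩
    exact fun hτ => hR (hL _ hτ _ h)

theorem List.eq_of_countP_le_one {α : Type*} {p : α → Bool} {l : List α} (h : l.countP p ≤ 1)
    {x y : α} (hx : x ∈ l) (hy : y ∈ l) (hpx : p x) (hpy : p y) : x = y := by
  rw [List.countP_eq_length_filter] at h
  have hx' : x ∈ l.filter p := List.mem_filter.2 ⟨hx, hpx⟩
  have hy' : y ∈ l.filter p := List.mem_filter.2 ⟨hy, hpy⟩
  match hl : l.filter p, h with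
  | [], _ => simp [hl] at hx'
  | [z], _ =>
    rw [hl, List.mem_singleton] at hx' hy'
    rw [hx', hy']

theorem IsCellShelling.exists_morseShelling [Nonempty V] {n a o : ℕ} {L K : Finset (Finset V)}
    {bs : List (Cell V)} (hL : IsComplex L) (h : IsCellShelling n L a o K bs)
    (hfin : ∀ b ∈ bs, ¬ b.IsUnfinished L) :
    ∃ (f : Cell V → MorseTile V), IsMorseShelling (relFaces K L) (bs.map f) ∧
      ∀ b ∈ bs, ((f b).order = 0 ↔ b.res = ∅) ∧ ((f b).IsOpenSimplex ↔ b.res = b.simplex) := by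
  have hex : ∀ b : Cell V, ∃ T : MorseTile V, b ∈ bs → T.simplex = b.simplex ∧ T.res = b.res ∧
      (T.IsOpenSimplex ↔ b.res = b.simplex) ∧
      ∀ τ, τ ∈ T.faceSet ↔ τ ⊆ b.simplex ∧ b.res ⊆ τ ∧ τ ∉ L ∧ τ ≠ ∅ := by
    intro b
    by_cases hb : b ∈ bs
    · obtain ⟨T, hT⟩ := (h.compatible b hb).exists_morseTile hL (hfin b hb)
      exact ⟨T, fun _ => hT⟩
    · let x := Classical.arbitrary V
      exact ⟨⟨{x}, ∅, none, by simp, by simp, by simp, by simp, by simp⟩, fun h => absurd h hb⟩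
  choose f hf using hex
  have hmemS : ∀ b ∈ bs, ∀ τ, τ ∈ (f b).faceSet ↔
      τ ∈ relFaces K L ∧ τ ⊆ b.simplex ∧ b.res ⊆ τ := by
    intro b hb τ
    rw [(hf b hb).2.2.2 τ, mem_relFaces]
    have := h.isComplex _ (h.mem b hb) τ
    tauto
  have hunion : ∀ l : List (Cell V), l ⊆ bs → IsShelled (relFaces K L) (fun _ => False) l →
      ∀ τ, τ ∈ faceUnion (l.map f) ↔ τ ∈ relFaces K L ∧ ∃ b ∈ l, τ ⊆ b.simplex := by
    intro l hl hsh τ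
    simp only [mem_faceUnion, List.mem_map, exists_exists_and_eq_and]
    constructor
    · rintro ⟨b, hb, hτ⟩
      have := (hmemS b (hl hb) τ).1 hτ
      exact ⟨this.1, b, hb, this.2.1⟩
    · rintro ⟨hτ, b, hb, hτb⟩
      obtain ⟨c, hc, h1, h2⟩ := hsh.exists_of_subset hb hτ hτb (by simp)
      exact ⟨c, hc, (hmemS c (hl hc) τ).2 ⟨hτ, h2, h1⟩⟩
  have hall : faceUnion (bs.map f) = relFaces K L := by
    ext τ
    rw [hunion bs (fun _ h => h) h.shelled]
    exact ⟨fun h => h.1, fun hτ => ⟨hτ, h.cover τ (mem_relFaces.1 hτ).1⟩⟩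
  refine ⟨f, ⟨⟨?_, hall, ?_⟩, ?_⟩, ?_⟩
  · rw [List.pairwise_map]
    refine (List.Pairwise.and_mem.1 h.shelled.pairwise).imp ?_
    rintro b c ⟨hb, hc, hbc⟩
    rw [Finset.disjoint_left]
    intro τ hτb hτc
    rw [hmemS b hb] at hτb
    rw [hmemS c hc] at hτc
    exact hbc τ hτb.1 hτb.2.1 hτc.2.1 hτc.2.2
  · intro d
    have hdim : ∀ T ∈ bs.map f, T.dim = n := by
      intro T hT
      obtain ⟨b, hb, rfl⟩ := List.mem_map.1 hT
      rw [MorseTile.dim, (hf b hb).1, (h.compatible b hb).card_simplex, Nat.add_sub_cancel]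
    by_cases hd : d ≤ n
    · rw [List.filter_eq_self.2 fun T hT => by simp [hdim T hT, hd], hall]
      exact fun τ hτ _ _ _ _ => hτ
    · rw [List.filter_eq_nil_iff.2 fun T hT => by simpa [hdim T hT] using hd]
      intro τ _ _ α hα
      simp [faceUnion] at hα
  · intro p τ hτ _ α hα hτα
    have hsh := h.shelled
    rw [← List.take_append_drop p bs, IsShelled.append_iff] at hsh
    rw [← List.map_take, hunion _ (List.take_subset _ _) hsh.1] at hα ⊢
    obtain ⟨-, b, hb, hαb⟩ := hα
    exact ⟨hτ, b, hb, hτα.trans hαb⟩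
  · intro b hb
    refine ⟨?_, (hf b hb).2.2.1⟩
    rw [MorseTile.order, (hf b hb).2.1, Finset.card_eq_zero]

/-- every relative simplex carries a shellable Morse tiling after
finitely many stellar subdivisions at facets, with the stated tiles of order `0`
and open simplices. -/
theorem relative_simplex_morse_shellable_after_stellar_subdivisions
    {V : Type*} [DecidableEq V] [Infinite V] (n : ℕ) (σ : Finset V)
    (hσ : σ.card = n + 1)
    (L0 : Finset (Finset V)) (hL : IsComplex L0) (hLσ : L0 ⊆ σ.powerset)
    (hLp : σ ∉ L0) :
    ∃ (N : ℕ) (K L : ℕ → Finset (Finset V)) (θ : ℕ → Finset V) (v : ℕ → V),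
      K 0 = σ.powerset ∧ L 0 = L0 ∧
      (∀ i < N,
        IsFacetOf (relFaces (K i) (L i)) (θ i) ∧
        (∀ τ ∈ K i, v i ∉ τ) ∧
        K (i + 1) = stellar (K i) (θ i) (v i) ∧
        L (i + 1) = stellar (L i) (θ i) (v i)) ∧
      ∃ ts : List (MorseTile V),
        IsMorseShelling (relFaces (K N) (L N)) ts ∧
        ((∃ T ∈ ts, T.order = 0) ↔ ∀ ρ ⊆ σ, ρ.card = n → ρ ∉ L0) ∧
        (∀ T ∈ ts, ∀ T' ∈ ts, T.order = 0 → T'.order = 0 → T = T') ∧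
        ((∃ T ∈ ts, T.IsOpenSimplex) ↔ ∀ ρ ⊆ σ, ρ.card = n → ρ ∈ L0) ∧
        (∀ T ∈ ts, ∀ T' ∈ ts, T.IsOpenSimplex → T'.IsOpenSimplex → T = T') := by
  obtain ⟨N, C, θ, v, hC, hstep, bs, hbs, hfin⟩ :=
    (isCellShelling_powerset hσ hL hLσ hLp).exists_finished hL
  obtain ⟨f, hf, hfb⟩ := hbs.exists_morseShelling hL hfin
  have hzero := hbs.count_zero
  have hopen := hbs.count_open
  refine ⟨N, C, fun _ => L0, θ, v, hC, rfl, fun i hi => ?_, bs.map f, hf, ?_, ?_, ?_, ?_⟩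
  · obtain ⟨h1, h2, h3, h4⟩ := hstep i hi
    exact ⟨h1, h2, h3, (stellar_eq_self hL h4 _).symm⟩
  · simp only [List.mem_map, exists_exists_and_eq_and]
    have : (∃ b ∈ bs, (f b).order = 0) ↔
        0 < bs.countP (fun c => decide (c.res = ∅)) := by
      rw [List.countP_pos_iff]
      exact exists_congr fun b => and_congr_right fun hb => by simp [(hfb b hb).1]
    rw [this, hzero]
    split_ifs with h
    · exact iff_of_true one_pos h
    · exact iff_of_false (lt_irrefl 0) h
  · simp only [List.forall_mem_map]
    intro b hb c hc h1 h2
    rw [(hfb b hb).1] at h1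
    rw [(hfb c hc).1] at h2
    congr 1
    refine List.eq_of_countP_le_one (p := fun c => decide (c.res = ∅)) ?_ hb hc
      (by simpa using h1) (by simpa using h2)
    rw [hzero]
    split_ifs <;> simp
  · simp only [List.mem_map, exists_exists_and_eq_and]
    have : (∃ b ∈ bs, (f b).IsOpenSimplex) ↔
        0 < bs.countP (fun c => decide (c.res = c.simplex)) := by
      rw [List.countP_pos_iff]
      exact exists_congr fun b => and_congr_right fun hb => by simp [(hfb b hb).2]
    rw [this, hopen]
    split_ifs with h
    · exact iff_of_true one_pos h
    · exact iff_of_false (lt_irrefl 0) h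
  · simp only [List.forall_mem_map]
    intro b hb c hc h1 h2
    rw [(hfb b hb).2] at h1
    rw [(hfb c hc).2] at h2
    congr 1
    refine List.eq_of_countP_le_one (p := fun c => decide (c.res = c.simplex)) ?_ hb hc
      (by simpa using h1) (by simpa using h2)
    rw [hopen]
    split_ifs <;> simp
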